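/- Let ψ ∈ H^1(T), β ∈ R, and suppose ‖ψ‖_{L^2} = R_0 ≤ √(2/(9|β|)). Define E_1(ψ) = (1/2)‖ψ‖_{Ḣ^1}^2 + (3iβ/4)∫ ψ̄' ψ̄ ψ^2 + (β^2/4)‖ψ‖_{L^6}^6. Then (1/4)‖ψ‖_{Ḣ^1}^2 ≤ |E_1(ψ)| + (3/32) R_0^4. -/

import Mathlib

open MeasureTheory Real

/-- Normalized complex integral over the torus: `(1/2π) ∫_0^{2π} f`. -/
noncomputable def tAvgC (f : ℝ → ℂ) : ℂ :=
  (1 / (2 * π) : ℝ) * ∫ x in (0:ℝ)..(2 * π), f x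

/-- The `L^2` norm on the torus (normalized measure). -/
noncomputable def tL2Norm (u : ℝ → ℂ) : ℝ :=
  Real.sqrt ((1 / (2 * π)) * ∫ x in (0:ℝ)..(2 * π), ‖u x‖ ^ 2)

/-- The `L^6` norm on the torus (normalized measure). -/
noncomputable def tL6Norm (u : ℝ → ℂ) : ℝ :=
  ((1 / (2 * π)) * ∫ x in (0:ℝ)..(2 * π), ‖u x‖ ^ 6) ^ ((1:ℝ)/6)

/-- The homogeneous `Ḣ^1` norm on the torus. -/
noncomputable def tH1dotNorm (u : ℝ → ℂ) : ℝ :=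
  Real.sqrt ((1 / (2 * π)) * ∫ x in (0:ℝ)..(2 * π), ‖deriv u x‖ ^ 2)

/-- The DNLS energy functional
`E₁(ψ) = (1/2)‖ψ‖_{Ḣ¹}² + (3iβ/4) ∫ ψ̄' ψ̄ ψ² + (β²/4) ‖ψ‖_{L⁶}⁶`. -/
noncomputable def energyE1 (β : ℝ) (ψ : ℝ → ℂ) : ℂ :=
  (1 / 2 * tH1dotNorm ψ ^ 2 : ℝ) +
    (3 * Complex.I * β / 4) *
      (tAvgC fun x => (starRingEnd ℂ) (deriv ψ x) * (starRingEnd ℂ) (ψ x) * ψ x ^ 2) +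
    ((β ^ 2 / 4) * tL6Norm ψ ^ 6 : ℝ)

lemma aux_mass (ρ : ℝ → ℝ) (hρ : Continuous ρ) (h0 : ∀ x, 0 ≤ ρ x) (a b c : ℝ) (hab : a ≤ b)
    (hc : 0 ≤ c) (hcM : c * (∫ x in a..b, ρ x) < π) :
    ∃ g : ℝ → ℝ, ∀ x ∈ Set.Icc a b, HasDerivAt g ((c ^ 2 + g x ^ 2) * ρ x) x := by
  set M := ∫ x in a..b, ρ x with hM
  set m : ℝ → ℝ := fun x => ∫ t in a..x, ρ t with hm
  have hmd : ∀ x, HasDerivAt m (ρ x) x := fun x =>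
    intervalIntegral.integral_hasDerivAt_right (hρ.intervalIntegrable _ _)
      (hρ.stronglyMeasurableAtFilter _ _) hρ.continuousAt
  have hmono : Monotone m := monotone_of_deriv_nonneg (fun x => (hmd x).differentiableAt)
    (fun x => by rw [(hmd x).deriv]; exact h0 x)
  refine ⟨fun x => c * Real.tan (c * (m x - M / 2)), fun x hx => ?_⟩
  have h1 : 0 ≤ m x := by
    have := hmono hx.1
    simpa [hm] using this
  have h2 : m x ≤ M := hmono hx.2
  have h3 : c * m x ≤ c * M := mul_le_mul_of_nonneg_left h2 hc
  have h4 : 0 ≤ c * m x := mul_nonneg hc h1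
  have hcos : 0 < Real.cos (c * (m x - M / 2)) := by
    apply Real.cos_pos_of_mem_Ioo
    constructor <;> nlinarith
  have hd := ((Real.hasDerivAt_tan hcos.ne').comp x (((hmd x).sub_const (M / 2)).const_mul c)).const_mul c
  refine hd.congr_deriv ?_
  have h5 := Real.sin_sq_add_cos_sq (c * (m x - M / 2))
  beta_reduce
  rw [Real.tan_eq_sin_div_cos]
  generalize Real.cos (c * (m x - M / 2)) = C at *
  generalize Real.sin (c * (m x - M / 2)) = S at *
  have hC := hcos.ne'
  field_simp
  linear_combination (-(c ^ 2 * ρ x)) * h5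

lemma core_vanish (u w u' w' : ℝ → ℝ) (hu : ∀ x, HasDerivAt u (u' x) x)
    (hw : ∀ x, HasDerivAt w (w' x) x) (hu' : Continuous u') (hw' : Continuous w')
    (a b c μ : ℝ) (hab : a ≤ b) (hc : 0 ≤ c)
    (hcM : c * (∫ x in a..b, (u x ^ 2 + w x ^ 2)) < π)
    (ua : u a = 0) (wa : w a = 0) (ub : u b = 0) (wb : w b = 0) :
    0 ≤ ∫ x in a..b, (u' x ^ 2 + w' x ^ 2 + 2 * μ * (u x ^ 2 + w x ^ 2) * (u x * w' x - w x * u' x)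
      + (μ ^ 2 - c ^ 2 / 4) * (u x ^ 2 + w x ^ 2) ^ 3) := by
  have cu : Continuous u := continuous_iff_continuousAt.2 fun x => (hu x).continuousAt
  have cw : Continuous w := continuous_iff_continuousAt.2 fun x => (hw x).continuousAt
  obtain ⟨g, hg⟩ := aux_mass (fun x => u x ^ 2 + w x ^ 2) (by fun_prop) (fun x => by positivity)
    a b c hab hc hcM
  have key := intervalIntegral.sub_le_integral_of_hasDeriv_right_of_le (a := a) (b := b)
    (g := fun x => -(g x * (u x ^ 2 + w x ^ 2) ^ 2 / 4))
    (g' := fun x => -(((c ^ 2 + g x ^ 2) * (u x ^ 2 + w x ^ 2) * (u x ^ 2 + w x ^ 2) ^ 2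
      + g x * (2 * (u x ^ 2 + w x ^ 2) * (2 * u x * u' x + 2 * w x * w' x))) / 4))
    (φ := fun x => (u' x ^ 2 + w' x ^ 2 + 2 * μ * (u x ^ 2 + w x ^ 2) * (u x * w' x - w x * u' x)
      + (μ ^ 2 - c ^ 2 / 4) * (u x ^ 2 + w x ^ 2) ^ 3)) hab ?_ ?_ ?_ ?_
  · simpa [ua, wa, ub, wb] using key
  · intro x hx
    have := (hg x hx).continuousAt
    have h1 := cu.continuousAt (x := x)
    have h2 := cw.continuousAt (x := x)
    apply ContinuousAt.continuousWithinAt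
    fun_prop
  · intro x hx
    have h := ((hg x (Set.Ioo_subset_Icc_self hx)).mul
      ((((hu x).pow 2).add ((hw x).pow 2)).pow 2)).div_const 4 |>.neg
    apply HasDerivAt.hasDerivWithinAt
    refine h.congr_deriv ?_
    simp
  · apply Continuous.integrableOn_Icc
    fun_prop
  · intro x hx
    have h1 := sq_nonneg (u' x + (u x ^ 2 + w x ^ 2) * (g x / 2 * u x - μ * w x))
    have h2 := sq_nonneg (w' x + (u x ^ 2 + w x ^ 2) * (g x / 2 * w x + μ * u x))
    nlinarith [h1, h2]

lemma wirt (ρ f f' : ℝ → ℝ) (hρ : Continuous ρ) (h0 : ∀ x, 0 < ρ x)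
    (hf : ∀ x, HasDerivAt f (f' x) x) (hf' : Continuous f')
    (a b c : ℝ) (hab : a ≤ b) (hc : 0 ≤ c) (hcM : c * (∫ x in a..b, ρ x) < π)
    (fa : f a = 0) (fb : f b = 0) :
    0 ≤ ∫ x in a..b, (f' x ^ 2 / ρ x - c ^ 2 * f x ^ 2 * ρ x) := by
  have cf : Continuous f := continuous_iff_continuousAt.2 fun x => (hf x).continuousAt
  obtain ⟨g, hg⟩ := aux_mass ρ hρ (fun x => (h0 x).le) a b c hab hc hcM
  have key := intervalIntegral.sub_le_integral_of_hasDeriv_right_of_le (a := a) (b := b)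
    (g := fun x => -(g x * f x ^ 2))
    (g' := fun x => -((c ^ 2 + g x ^ 2) * ρ x * f x ^ 2 + g x * (2 * f x * f' x)))
    (φ := fun x => (f' x ^ 2 / ρ x - c ^ 2 * f x ^ 2 * ρ x)) hab ?_ ?_ ?_ ?_
  · simpa [fa, fb] using key
  · intro x hx
    have := (hg x hx).continuousAt
    have h1 := cf.continuousAt (x := x)
    apply ContinuousAt.continuousWithinAt
    fun_prop
  · intro x hx
    have h := ((hg x (Set.Ioo_subset_Icc_self hx)).mul ((hf x).pow 2)).neg
    apply HasDerivAt.hasDerivWithinAt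
    refine h.congr_deriv ?_
    simp
  · apply Continuous.integrableOn_Icc
    have : ∀ x, ρ x ≠ 0 := fun x => (h0 x).ne'
    fun_prop (disch := assumption)
  · intro x hx
    have hp := h0 x
    have e : f' x ^ 2 / ρ x - c ^ 2 * f x ^ 2 * ρ x
      - -((c ^ 2 + g x ^ 2) * ρ x * f x ^ 2 + g x * (2 * f x * f' x))
      = (f' x + g x * ρ x * f x) ^ 2 / ρ x := by
      field_simp
      ring
    have : 0 ≤ (f' x + g x * ρ x * f x) ^ 2 / ρ x := by positivity
    linarith

/-- Wirtinger on a full period for an antiperiodic function. -/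
lemma wirt_anti (ρ f f' : ℝ → ℝ) (hρ : Continuous ρ) (h0 : ∀ x, 0 < ρ x)
    (hρp : Function.Periodic ρ (2 * π))
    (hf : ∀ x, HasDerivAt f (f' x) x) (hf' : Continuous f')
    (hfa : ∀ x, f (x + 2 * π) = - f x) (hfa' : ∀ x, f' (x + 2 * π) = - f' x)
    (c : ℝ) (hc : 0 ≤ c) (hcM : c * (∫ x in (0:ℝ)..(2 * π), ρ x) < π) :
    0 ≤ ∫ x in (0:ℝ)..(2 * π), (f' x ^ 2 / ρ x - c ^ 2 * f x ^ 2 * ρ x) := by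
  have cf : Continuous f := continuous_iff_continuousAt.2 fun x => (hf x).continuousAt
  have hpi := Real.pi_pos
  obtain ⟨a, ha⟩ : ∃ a, f a = 0 := by
    have h1 := hfa 0
    have : (0:ℝ) ∈ Set.range f := by
      rcases le_total (f 0) 0 with h | h
      · exact mem_range_of_exists_le_of_exists_ge cf ⟨0, h⟩ ⟨0 + 2 * π, by linarith⟩
      · exact mem_range_of_exists_le_of_exists_ge cf ⟨0 + 2 * π, by linarith⟩ ⟨0, h⟩
    exact this
  have hper : Function.Periodic (fun x => f' x ^ 2 / ρ x - c ^ 2 * f x ^ 2 * ρ x) (2 * π) := by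
    intro x
    simp only [hfa, hfa', hρp x]
    ring
  have e1 := hper.intervalIntegral_add_eq 0 a
  have e2 := hρp.intervalIntegral_add_eq 0 a
  rw [zero_add] at e1 e2
  rw [e1]
  rw [e2] at hcM
  exact wirt ρ f f' hρ h0 hf hf' a (a + 2 * π) c (by linarith) hc hcM ha (by rw [hfa, ha, neg_zero])

lemma twisted (ρ ρ' ζ : ℝ → ℝ) (h0 : ∀ x, 0 < ρ x) (hρ : ∀ x, HasDerivAt ρ (ρ' x) x)
    (hρ' : Continuous ρ') (hρp : Function.Periodic ρ (2 * π)) (hρp' : Function.Periodic ρ' (2 * π))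
    (hζ : Continuous ζ) (hζp : Function.Periodic ζ (2 * π))
    (hI : ∫ x in (0:ℝ)..(2 * π), ζ x = π)
    (c : ℝ) (hc : 0 ≤ c) (hcM : c * (∫ x in (0:ℝ)..(2 * π), ρ x) < π) :
    0 ≤ ∫ x in (0:ℝ)..(2 * π), (ρ' x ^ 2 / ρ x + ρ x * ζ x ^ 2 - c ^ 2 * ρ x ^ 3) := by
  have cρ : Continuous ρ := continuous_iff_continuousAt.2 fun x => (hρ x).continuousAt
  set Φ : ℝ → ℝ := fun x => ∫ t in (0:ℝ)..x, ζ t with hΦ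
  have hΦd : ∀ x, HasDerivAt Φ (ζ x) x := fun x =>
    intervalIntegral.integral_hasDerivAt_right (hζ.intervalIntegrable _ _)
      (hζ.stronglyMeasurableAtFilter _ _) hζ.continuousAt
  have cΦ : Continuous Φ := continuous_iff_continuousAt.2 fun x => (hΦd x).continuousAt
  have hΦp : ∀ x, Φ (x + 2 * π) = Φ x + π := by
    intro x
    have e := hζp.intervalIntegral_add_eq 0 x
    rw [zero_add, hI] at e
    have := intervalIntegral.integral_add_adjacent_intervals (μ := volume) (hζ.intervalIntegrable 0 x)
      (hζ.intervalIntegrable x (x + 2 * π))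
    simp only [hΦ]
    rw [← this, ← e]
  have k1 := wirt_anti ρ (fun x => ρ x * Real.cos (Φ x))
    (fun x => ρ' x * Real.cos (Φ x) + ρ x * (- Real.sin (Φ x) * ζ x)) cρ h0 hρp
    (fun x => (hρ x).mul ((hΦd x).cos)) (by fun_prop)
    (fun x => by rw [hρp x, hΦp, Real.cos_add_pi]; ring)
    (fun x => by rw [hρp x, hΦp, hρp' x, hζp x, Real.cos_add_pi, Real.sin_add_pi]; ring) c hc hcM
  have k2 := wirt_anti ρ (fun x => ρ x * Real.sin (Φ x))
    (fun x => ρ' x * Real.sin (Φ x) + ρ x * (Real.cos (Φ x) * ζ x)) cρ h0 hρp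
    (fun x => (hρ x).mul ((hΦd x).sin)) (by fun_prop)
    (fun x => by rw [hρp x, hΦp, Real.sin_add_pi]; ring)
    (fun x => by rw [hρp x, hΦp, hρp' x, hζp x, Real.cos_add_pi, Real.sin_add_pi]; ring) c hc hcM
  have hne : ∀ x, ρ x ≠ 0 := fun x => (h0 x).ne'
  have k3 := add_nonneg k1 k2
  rw [← intervalIntegral.integral_add] at k3
  · refine k3.trans_eq (intervalIntegral.integral_congr fun x _ => ?_)
    beta_reduce
    have hp := h0 x
    have e := Real.sin_sq_add_cos_sq (Φ x)
    have hx := hne x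
    have e2 : ∀ r p s q C S : ℝ, r ≠ 0 →
        (p * C + r * (-S * s)) ^ 2 / r - q ^ 2 * (r * C) ^ 2 * r
        + ((p * S + r * (C * s)) ^ 2 / r - q ^ 2 * (r * S) ^ 2 * r)
        = (S ^ 2 + C ^ 2) * (p ^ 2 / r + r * s ^ 2 - q ^ 2 * r ^ 3) := by
      intro r p s q C S hr
      field_simp
      ring
    rw [e2 _ _ _ _ _ _ hx, e, one_mul]
  · apply Continuous.intervalIntegrable
    fun_prop (disch := assumption)
  · apply Continuous.intervalIntegrable
    fun_prop (disch := assumption)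

lemma winding (ψ : ℝ → ℂ) (hψ : ContDiff ℝ 1 ψ) (hper : Function.Periodic ψ (2 * π))
    (hne : ∀ x, ψ x ≠ 0) :
    ∃ n : ℤ, ∫ x in (0:ℝ)..(2 * π), (deriv ψ x / ψ x).im = 2 * π * n := by
  have cψ := hψ.continuous
  have cd : Continuous (deriv ψ) := hψ.continuous_deriv le_rfl
  have cq : Continuous (fun x => deriv ψ x / ψ x) := cd.div cψ hne
  set L : ℝ → ℂ := fun x => ∫ t in (0:ℝ)..x, deriv ψ t / ψ t with hL
  have hLd : ∀ x, HasDerivAt L (deriv ψ x / ψ x) x := fun x =>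
    intervalIntegral.integral_hasDerivAt_right (cq.intervalIntegrable _ _)
      (cq.stronglyMeasurableAtFilter _ _) cq.continuousAt
  have hψd : ∀ x, HasDerivAt ψ (deriv ψ x) x := fun x =>
    (hψ.differentiable one_ne_zero x).hasDerivAt
  have hK : ∀ x, HasDerivAt (fun x => ψ x * Complex.exp (-L x)) 0 x := by
    intro x
    have h := (hψd x).mul ((hLd x).neg.cexp)
    refine h.congr_deriv ?_
    have := hne x
    field_simp
    simp
  have hconst := is_const_of_deriv_eq_zero (fun x => (hK x).differentiableAt)
    (fun x => (hK x).deriv) 0 (2 * π)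
  have e0 : ψ (2 * π) = ψ 0 := by simpa using hper 0
  have hL0 : L 0 = 0 := by simp [hL]
  simp only [e0, hL0, neg_zero, Complex.exp_zero] at hconst
  have h1 : Complex.exp (-L (2 * π)) = 1 := (mul_left_cancel₀ (hne 0) hconst).symm
  obtain ⟨n, hn⟩ := Complex.exp_eq_one_iff.1 h1
  refine ⟨-n, ?_⟩
  have h2 := Complex.imCLM.intervalIntegral_comp_comm (cq.intervalIntegrable (μ := volume) 0 (2 * π))
  simp only [Complex.imCLM_apply] at h2
  rw [h2]
  change (L (2 * π)).im = _
  have : L (2 * π) = -(n * (2 * π * Complex.I)) := by rw [← hn]; ring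
  rw [this]
  simp
  ring

set_option maxHeartbeats 1000000 in
lemma core (β : ℝ) (hβ : β ≠ 0) (ψ : ℝ → ℂ)
    (hψ : ContDiff ℝ 1 ψ) (hper : Function.Periodic ψ (2 * π))
    (hM : |β| * (∫ x in (0:ℝ)..(2 * π), ((ψ x).re ^ 2 + (ψ x).im ^ 2)) ≤ 4 * π / 9) :
    0 ≤ ∫ x in (0:ℝ)..(2 * π), ((deriv ψ x).re ^ 2 + (deriv ψ x).im ^ 2
      + 3 * β * ((ψ x).re ^ 2 + (ψ x).im ^ 2)
        * ((ψ x).re * (deriv ψ x).im - (ψ x).im * (deriv ψ x).re)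
      + β ^ 2 * ((ψ x).re ^ 2 + (ψ x).im ^ 2) ^ 3) := by
  have hpi := Real.pi_pos
  have cψ := hψ.continuous
  have cd : Continuous (deriv ψ) := hψ.continuous_deriv le_rfl
  have hψd : ∀ x, HasDerivAt ψ (deriv ψ x) x := fun x =>
    (hψ.differentiable one_ne_zero x).hasDerivAt
  have hperd : Function.Periodic (deriv ψ) (2 * π) := by
    intro x
    have : (fun y => ψ (y + 2 * π)) = ψ := funext hper
    rw [← deriv_comp_add_const, this]
  have hre : ∀ x, HasDerivAt (fun x => (ψ x).re) (deriv ψ x).re x := fun x =>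
    Complex.reCLM.hasFDerivAt.comp_hasDerivAt x (hψd x)
  have him : ∀ x, HasDerivAt (fun x => (ψ x).im) (deriv ψ x).im x := fun x =>
    Complex.imCLM.hasFDerivAt.comp_hasDerivAt x (hψd x)
  have cre : Continuous fun x => (ψ x).re := Complex.continuous_re.comp cψ
  have cim : Continuous fun x => (ψ x).im := Complex.continuous_im.comp cψ
  have cre' : Continuous fun x => (deriv ψ x).re := Complex.continuous_re.comp cd
  have cim' : Continuous fun x => (deriv ψ x).im := Complex.continuous_im.comp cd
  have hρp : Function.Periodic (fun x => (ψ x).re ^ 2 + (ψ x).im ^ 2) (2 * π) := by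
    intro x; simp only [hper x]
  set M := ∫ x in (0:ℝ)..(2 * π), ((ψ x).re ^ 2 + (ψ x).im ^ 2) with hMdef
  have h5 : Real.sqrt 5 ^ 2 = 5 := Real.sq_sqrt (by norm_num)
  have h50 : 0 ≤ Real.sqrt 5 := Real.sqrt_nonneg 5
  have h5lt : Real.sqrt 5 < 9 / 4 := by nlinarith
  have hc0 : 0 ≤ Real.sqrt 5 * |β| := by positivity
  have hcsq : (Real.sqrt 5 * |β|) ^ 2 = 5 * β ^ 2 := by rw [mul_pow, h5, sq_abs]
  have hcM : Real.sqrt 5 * |β| * M < π := by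
    calc Real.sqrt 5 * |β| * M = Real.sqrt 5 * (|β| * M) := by ring
      _ ≤ Real.sqrt 5 * (4 * π / 9) := by gcongr
      _ < 9 / 4 * (4 * π / 9) := by gcongr
      _ = π := by ring
  by_cases hz : ∃ a, ψ a = 0
  · obtain ⟨a, ha⟩ := hz
    have hP : Function.Periodic (fun x => (deriv ψ x).re ^ 2 + (deriv ψ x).im ^ 2
      + 3 * β * ((ψ x).re ^ 2 + (ψ x).im ^ 2)
        * ((ψ x).re * (deriv ψ x).im - (ψ x).im * (deriv ψ x).re)
      + β ^ 2 * ((ψ x).re ^ 2 + (ψ x).im ^ 2) ^ 3) (2 * π) := by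
      intro x; simp only [hper x, hperd x]
    have e1 := hP.intervalIntegral_add_eq 0 a
    have e2 := hρp.intervalIntegral_add_eq 0 a
    rw [zero_add] at e1 e2
    rw [e1]
    rw [hMdef, e2] at hcM
    have hb : ψ (a + 2 * π) = 0 := by rw [hper, ha]
    have k := core_vanish _ _ _ _ hre him cre' cim' a (a + 2 * π) _ (3 * β / 2) (by linarith) hc0 hcM
      (by simp [ha]) (by simp [ha]) (by simp [hb]) (by simp [hb])
    convert k using 2
    ext x
    rw [hcsq]
    ring
  · push Not at hz
    set ρ : ℝ → ℝ := fun x => (ψ x).re ^ 2 + (ψ x).im ^ 2 with hρdef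
    have h0 : ∀ x, 0 < ρ x := by
      intro x
      have := Complex.normSq_pos.2 (hz x)
      rw [Complex.normSq_apply] at this
      simp only [hρdef]
      nlinarith
    have hne : ∀ x, ρ x ≠ 0 := fun x => (h0 x).ne'
    have cρ : Continuous ρ := by fun_prop
    have hMpos : 0 < M := intervalIntegral.intervalIntegral_pos_of_pos
      (cρ.intervalIntegrable _ _) h0 (by linarith)
    set ρ' : ℝ → ℝ := fun x => 2 * (ψ x).re * (deriv ψ x).re + 2 * (ψ x).im * (deriv ψ x).im
      with hρ'def
    have cρ' : Continuous ρ' := by fun_prop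
    have hρd : ∀ x, HasDerivAt ρ (ρ' x) x := by
      intro x
      refine (((hre x).pow 2).add ((him x).pow 2)).congr_deriv ?_
      simp [hρ'def]
    have hρp' : Function.Periodic ρ' (2 * π) := by
      intro x; simp only [hρ'def, hper x, hperd x]
    obtain ⟨n, hn⟩ := winding ψ hψ hper hz
    set κ : ℝ → ℝ := fun x => ((ψ x).re * (deriv ψ x).im - (ψ x).im * (deriv ψ x).re) / ρ x with hκ
    have hκe : ∀ x, (deriv ψ x / ψ x).im = κ x := by
      intro x
      have := hne x
      rw [Complex.div_im, Complex.normSq_apply]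
      simp only [hκ, hρdef] at this ⊢
      rw [← sub_div]
      congr 1 <;> ring
    simp only [hκe] at hn
    have cκ : Continuous κ := by
      simp only [hκ]
      fun_prop (disch := assumption)
    set η : ℝ → ℝ := fun x => κ x + 3 * β / 2 * ρ x with hη
    have cη : Continuous η := by fun_prop
    have hηp : Function.Periodic η (2 * π) := by
      intro x; simp only [hη, hκ, hρdef, hper x, hperd x]
    have hIη : ∫ x in (0:ℝ)..(2 * π), η x = 2 * π * n + 3 * β / 2 * M := by
      simp only [hη]
      rw [intervalIntegral.integral_add (cκ.intervalIntegrable _ _)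
        ((cρ.const_mul _).intervalIntegrable _ _) , hn, intervalIntegral.integral_const_mul]
    set I := 2 * π * n + 3 * β / 2 * M with hI
    have habs : |3 * β / 2 * M| ≤ 2 * π / 3 := by
      rw [abs_mul, abs_div, abs_mul, abs_of_pos hMpos]
      norm_num
      linarith
    have hbM : 3 * β / 2 * M ≠ 0 := by
      have := hMpos.ne'
      positivity
    have hIbig : n ≠ 0 → π / 2 < |I| := by
      intro hn0
      have h1 : (1:ℝ) ≤ |(n:ℝ)| := by exact_mod_cast Int.one_le_abs hn0
      have h2 : |2 * π * (n:ℝ)| = 2 * π * |(n:ℝ)| := by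
        rw [abs_mul, abs_of_pos (by positivity : (0:ℝ) < 2 * π)]
      have h3 := abs_sub_abs_le_abs_sub (2 * π * (n:ℝ)) (-(3 * β / 2 * M))
      rw [sub_neg_eq_add, abs_neg, h2] at h3
      nlinarith
    have hI0 : I ≠ 0 := by
      by_cases hn0 : n = 0
      · simpa [hI, hn0] using hbM
      · intro h
        have := hIbig hn0
        rw [h, abs_zero] at this
        linarith
    have hζI : ∫ x in (0:ℝ)..(2 * π), π / I * η x = π := by
      rw [intervalIntegral.integral_const_mul, hIη]
      field_simp
    have T := fun c hc hcM => twisted ρ ρ' (fun x => π / I * η x) h0 hρd cρ' hρp hρp' (by fun_prop)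
      (fun x => by simp only [hηp x]) hζI c hc hcM
    -- rewrite the target integrand
    have hW : ∀ x, (deriv ψ x).re ^ 2 + (deriv ψ x).im ^ 2
      + 3 * β * ρ x * ((ψ x).re * (deriv ψ x).im - (ψ x).im * (deriv ψ x).re)
      + β ^ 2 * ρ x ^ 3 = (1 / 4) * (ρ' x ^ 2 / ρ x + 4 * (ρ x * η x ^ 2) - 5 * β ^ 2 * ρ x ^ 3) := by
      intro x
      have hx := hne x
      have e : (deriv ψ x).re ^ 2 + (deriv ψ x).im ^ 2 = (ρ' x ^ 2 / 4 +
        ((ψ x).re * (deriv ψ x).im - (ψ x).im * (deriv ψ x).re) ^ 2) / ρ x := by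
        rw [eq_div_iff hx]
        simp only [hρdef, hρ'def]
        ring
      rw [e]
      simp only [hη, hκ]
      generalize (ψ x).re * (deriv ψ x).im - (ψ x).im * (deriv ψ x).re = j
      field_simp
      ring
    change 0 ≤ ∫ x in (0:ℝ)..(2 * π), ((deriv ψ x).re ^ 2 + (deriv ψ x).im ^ 2
      + 3 * β * ρ x * ((ψ x).re * (deriv ψ x).im - (ψ x).im * (deriv ψ x).re)
      + β ^ 2 * ρ x ^ 3)
    simp only [hW]
    rw [intervalIntegral.integral_const_mul]
    apply mul_nonneg (by norm_num)
    rcases le_or_gt (π / 2) |I| with hcase | hcase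
    · refine (T _ hc0 hcM).trans ?_
      apply intervalIntegral.integral_mono_on (by linarith)
      · apply Continuous.intervalIntegrable
        fun_prop (disch := assumption)
      · apply Continuous.intervalIntegrable
        fun_prop (disch := assumption)
      · intro x _
        rw [hcsq]
        have h1 : (π / I) ^ 2 ≤ 4 := by
          rw [div_pow, div_le_iff₀ (by positivity), ← sq_abs I]
          nlinarith
        have h2 : 0 ≤ ρ x * η x ^ 2 := mul_nonneg (h0 x).le (sq_nonneg _)
        nlinarith [mul_le_mul_of_nonneg_right h1 h2]
    · have hn0 : n = 0 := by
        by_contra h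
        linarith [hIbig h]
      have hIe : I = 3 * β / 2 * M := by simp [hI, hn0]
      have hc' : Real.sqrt 5 * π / (3 * M) * M < π := by
        have : Real.sqrt 5 * π / (3 * M) * M = Real.sqrt 5 / 3 * π := by field_simp
        rw [this]
        nlinarith
      have t := T (Real.sqrt 5 * π / (3 * M)) (by positivity) hc'
      have hs : 0 ≤ 4 * I ^ 2 / π ^ 2 := by positivity
      have t2 := mul_nonneg hs t
      rw [← intervalIntegral.integral_const_mul] at t2
      refine t2.trans ?_
      apply intervalIntegral.integral_mono_on (by linarith)
      · apply Continuous.intervalIntegrable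
        fun_prop (disch := assumption)
      · apply Continuous.intervalIntegrable
        fun_prop (disch := assumption)
      · intro x _
        have h1 : 4 * I ^ 2 / π ^ 2 ≤ 1 := by
          rw [div_le_one (by positivity), ← sq_abs I]
          nlinarith [abs_nonneg I]
        have h2 : 0 ≤ ρ' x ^ 2 / ρ x := div_nonneg (sq_nonneg _) (h0 x).le
        have e : 4 * I ^ 2 / π ^ 2 * (ρ' x ^ 2 / ρ x + ρ x * (π / I * η x) ^ 2
          - (Real.sqrt 5 * π / (3 * M)) ^ 2 * ρ x ^ 3)
          = 4 * I ^ 2 / π ^ 2 * (ρ' x ^ 2 / ρ x) + 4 * (ρ x * η x ^ 2) - 5 * β ^ 2 * ρ x ^ 3 := by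
          have e1 : 4 * I ^ 2 / π ^ 2 * (π / I) ^ 2 = 4 := by field_simp
          have e2 : 4 * I ^ 2 / π ^ 2 * (Real.sqrt 5 * π / (3 * M)) ^ 2 = 5 * β ^ 2 := by
            have e3 : ∀ q : ℝ, 4 * (3 * β / 2 * M) ^ 2 / π ^ 2 * (q * π / (3 * M)) ^ 2
                = q ^ 2 * β ^ 2 := by
              intro q
              field_simp
              ring
            rw [hIe, e3, h5]
          linear_combination (ρ x * η x ^ 2) * e1 - ρ x ^ 3 * e2
        rw [e]
        have h3 := mul_le_mul_of_nonneg_right h1 h2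
        linarith

/-- Control of the `Ḣ¹` norm by the energy for small `L²` data:
if `R₀ = ‖ψ‖_{L²} ≤ √(2/(9|β|))` then `(1/4)‖ψ‖_{Ḣ¹}² ≤ |E₁(ψ)| + (3/32) R₀⁴`. -/
theorem H1_control_by_energy (β : ℝ) (hβ : β ≠ 0) (ψ : ℝ → ℂ)
    (hψ : ContDiff ℝ 1 ψ) (hper : Function.Periodic ψ (2 * π))
    (R₀ : ℝ) (hR₀ : R₀ = tL2Norm ψ)
    (hsmall : R₀ ≤ Real.sqrt (2 / (9 * |β|))) :
    1 / 4 * tH1dotNorm ψ ^ 2 ≤ ‖energyE1 β ψ‖ + 3 / 32 * R₀ ^ 4 := by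
  have hpi := Real.pi_pos
  have cψ := hψ.continuous
  have cd : Continuous (deriv ψ) := hψ.continuous_deriv le_rfl
  have hsq : ∀ z : ℂ, ‖z‖ ^ 2 = z.re ^ 2 + z.im ^ 2 := by
    intro z
    rw [Complex.sq_norm, Complex.normSq_apply]; ring
  have cre : Continuous fun x => (ψ x).re := Complex.continuous_re.comp cψ
  have cim : Continuous fun x => (ψ x).im := Complex.continuous_im.comp cψ
  have cre' : Continuous fun x => (deriv ψ x).re := Complex.continuous_re.comp cd
  have cim' : Continuous fun x => (deriv ψ x).im := Complex.continuous_im.comp cd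
  have hMnn : 0 ≤ ∫ x in (0:ℝ)..(2 * π), ((ψ x).re ^ 2 + (ψ x).im ^ 2) :=
    intervalIntegral.integral_nonneg (by linarith) (fun x _ => by positivity)
  have hβ' : 0 < |β| := abs_pos.2 hβ
  have hM : |β| * (∫ x in (0:ℝ)..(2 * π), ((ψ x).re ^ 2 + (ψ x).im ^ 2)) ≤ 4 * π / 9 := by
    rw [hR₀, tL2Norm, Real.sqrt_le_sqrt_iff (by positivity)] at hsmall
    simp only [hsq] at hsmall
    rw [le_div_iff₀ (by positivity), one_div, mul_assoc, inv_mul_le_iff₀ (by positivity)] at hsmall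
    linarith
  have K := core β hβ ψ hψ hper hM
  have hA : tH1dotNorm ψ ^ 2 = (1 / (2 * π)) *
      ∫ x in (0:ℝ)..(2 * π), ((deriv ψ x).re ^ 2 + (deriv ψ x).im ^ 2) := by
    rw [tH1dotNorm, Real.sq_sqrt]
    · simp only [hsq]
    · exact mul_nonneg (by positivity)
        (intervalIntegral.integral_nonneg (by linarith) (fun x _ => by positivity))
  have hL : tL6Norm ψ ^ 6 = (1 / (2 * π)) *
      ∫ x in (0:ℝ)..(2 * π), ((ψ x).re ^ 2 + (ψ x).im ^ 2) ^ 3 := by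
    have h6 : ∀ x, ‖ψ x‖ ^ 6 = ((ψ x).re ^ 2 + (ψ x).im ^ 2) ^ 3 := by
      intro x
      rw [← hsq]; ring
    rw [tL6Norm, ← Real.rpow_natCast, ← Real.rpow_mul]
    · simp only [h6]
      norm_num
    · exact mul_nonneg (by positivity)
        (intervalIntegral.integral_nonneg (by linarith) (fun x _ => by positivity))
  have hT : (tAvgC fun x => (starRingEnd ℂ) (deriv ψ x) * (starRingEnd ℂ) (ψ x) * ψ x ^ 2).im
      = -((1 / (2 * π)) * ∫ x in (0:ℝ)..(2 * π), ((ψ x).re ^ 2 + (ψ x).im ^ 2)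
        * ((ψ x).re * (deriv ψ x).im - (ψ x).im * (deriv ψ x).re)) := by
    have cq : Continuous fun x => (starRingEnd ℂ) (deriv ψ x) * (starRingEnd ℂ) (ψ x) * ψ x ^ 2 := by
      fun_prop
    have h2 := Complex.imCLM.intervalIntegral_comp_comm
      (cq.intervalIntegrable (μ := volume) 0 (2 * π))
    simp only [Complex.imCLM_apply] at h2
    rw [tAvgC, Complex.im_ofReal_mul, ← h2, ← mul_neg, ← intervalIntegral.integral_neg]
    congr 2
    ext x
    simp [pow_two]
    ring
  have hE : (energyE1 β ψ).re = 1 / 2 * tH1dotNorm ψ ^ 2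
      - 3 * β / 4 * (tAvgC fun x => (starRingEnd ℂ) (deriv ψ x) * (starRingEnd ℂ) (ψ x) * ψ x ^ 2).im
      + (β ^ 2 / 4) * tL6Norm ψ ^ 6 := by
    have e : (3 * Complex.I * (β:ℂ) / 4) = ((3 * β / 4 : ℝ) : ℂ) * Complex.I := by
      push_cast; ring
    rw [energyE1, e, Complex.add_re, Complex.add_re, Complex.ofReal_re, Complex.ofReal_re, mul_assoc,
      Complex.re_ofReal_mul, Complex.I_mul_re]
    ring
  have hre := Complex.re_le_norm (energyE1 β ψ)
  have hR4 : 0 ≤ 3 / 32 * R₀ ^ 4 := by positivity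
  have hfin : (energyE1 β ψ).re - 1 / 4 * tH1dotNorm ψ ^ 2 = (1 / (8 * π)) *
      ∫ x in (0:ℝ)..(2 * π), ((deriv ψ x).re ^ 2 + (deriv ψ x).im ^ 2
      + 3 * β * ((ψ x).re ^ 2 + (ψ x).im ^ 2)
        * ((ψ x).re * (deriv ψ x).im - (ψ x).im * (deriv ψ x).re)
      + β ^ 2 * ((ψ x).re ^ 2 + (ψ x).im ^ 2) ^ 3) := by
    rw [hE, hT, hL, hA]
    simp only [mul_assoc (3 * β)]
    have i1 : IntervalIntegrable (fun x => (deriv ψ x).re ^ 2 + (deriv ψ x).im ^ 2) volume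
        0 (2 * π) := by
      apply Continuous.intervalIntegrable
      fun_prop
    have i2 : IntervalIntegrable (fun x => 3 * β * (((ψ x).re ^ 2 + (ψ x).im ^ 2)
        * ((ψ x).re * (deriv ψ x).im - (ψ x).im * (deriv ψ x).re))) volume 0 (2 * π) := by
      apply Continuous.intervalIntegrable
      fun_prop
    have i3 : IntervalIntegrable (fun x => β ^ 2 * ((ψ x).re ^ 2 + (ψ x).im ^ 2) ^ 3) volume
        0 (2 * π) := by
      apply Continuous.intervalIntegrable
      fun_prop
    rw [intervalIntegral.integral_add (i1.add i2) i3, intervalIntegral.integral_add i1 i2,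
      intervalIntegral.integral_const_mul, intervalIntegral.integral_const_mul]
    field_simp
    ring
  have : 0 ≤ (energyE1 β ψ).re - 1 / 4 * tH1dotNorm ψ ^ 2 := by
    rw [hfin]
    exact mul_nonneg (by positivity) K
  linarith
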